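/- For every n ≥ 0 and all real numbers α1, α2, α3, α4, s: Σ_{π ∈ S_{n+1}} α1^{pk(π)} α2^{val(π)} α3^{dasc(π)} α4^{ddes(π)} s^{simsuc(π)} = Σ_{σ ∈ S_n, cda(σ)=0} α1^{exc(σ)+1} α2^{exc(σ)} (s·α3+α4)^{fix(σ)} (s+1)^{cyc(σ)−fix(σ)} (α3+α4)^{n − fix(σ) − 2·exc(σ)}. -/

import Mathlib

open Finset

namespace SucEuler

/-- One-line notation word of a permutation: `word π i` is the value (in `1..n`)
at position `i ∈ {1,…,n}`, and `0` for positions outside `{1,…,n}`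
(this implements the conventions `π(0)=π(n+1)=0`). -/
def word {n : ℕ} (π : Equiv.Perm (Fin n)) (i : ℕ) : ℕ :=
  if h : 1 ≤ i ∧ i ≤ n then ((π ⟨i - 1, by omega⟩ : Fin n) : ℕ) + 1 else 0

/-- number of descents -/
def des {n : ℕ} (π : Equiv.Perm (Fin n)) : ℕ :=
  ((Finset.Icc 1 (n - 1)).filter fun i => word π (i + 1) < word π i).card

/-- number of ascents -/
def asc {n : ℕ} (π : Equiv.Perm (Fin n)) : ℕ :=
  ((Finset.Icc 1 (n - 1)).filter fun i => word π i < word π (i + 1)).card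

/-- number of successions -/
def suc {n : ℕ} (π : Equiv.Perm (Fin n)) : ℕ :=
  ((Finset.Icc 1 (n - 1)).filter fun i => word π (i + 1) = word π i + 1).card

/-- number of big ascents -/
def basc {n : ℕ} (π : Equiv.Perm (Fin n)) : ℕ :=
  ((Finset.Icc 1 (n - 1)).filter fun i => word π i + 2 ≤ word π (i + 1)).card

/-- number of excedances -/
def excStat {n : ℕ} (σ : Equiv.Perm (Fin n)) : ℕ :=
  (Finset.univ.filter fun i : Fin n => i < σ i).card

/-- number of fixed points -/
def fixStat {n : ℕ} (σ : Equiv.Perm (Fin n)) : ℕ :=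
  (Finset.univ.filter fun i : Fin n => σ i = i).card

/-- number of drops -/
def dropStat {n : ℕ} (σ : Equiv.Perm (Fin n)) : ℕ :=
  (Finset.univ.filter fun i : Fin n => σ i < i).card

/-- number of excedances at positions `i ≥ 2` -/
def excHat {n : ℕ} (σ : Equiv.Perm (Fin n)) : ℕ :=
  (Finset.univ.filter fun i : Fin n => 0 < (i : ℕ) ∧ i < σ i).card

/-- number of fixed points other than `1` -/
def fixHat {n : ℕ} (σ : Equiv.Perm (Fin n)) : ℕ :=
  (Finset.univ.filter fun i : Fin n => 0 < (i : ℕ) ∧ σ i = i).card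

/-- number of cycles (orbits) of a permutation -/
def cyc {n : ℕ} (σ : Equiv.Perm (Fin n)) : ℕ :=
  σ.cycleType.card + fixStat σ

/-- number of cycle double ascents: values `x` with `σ⁻¹(x) < x < σ(x)` -/
def cda {n : ℕ} (σ : Equiv.Perm (Fin n)) : ℕ :=
  (Finset.univ.filter fun x : Fin n => σ⁻¹ x < x ∧ x < σ x).card

open Classical in
/-- number of left-to-right minima -/
noncomputable def lrmin {n : ℕ} (π : Equiv.Perm (Fin n)) : ℕ :=
  ((Finset.Icc 1 n).filter fun i => ∀ j ∈ Finset.Icc 1 n, j < i → word π i < word π j).card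

open Classical in
/-- number of proper left-to-right minima -/
noncomputable def plrmin {n : ℕ} (π : Equiv.Perm (Fin n)) : ℕ :=
  ((Finset.Icc 1 n).filter fun i =>
    (∀ j ∈ Finset.Icc 1 n, j < i → word π i < word π j) ∧ word π i ≠ 1 ∧
      ∃ k ∈ Finset.Icc 1 n, i < k ∧ word π k = word π i - 1 ∧ word π (k + 1) < word π k).card

open Classical in
/-- number of simsun successions -/
noncomputable def simsuc {n : ℕ} (π : Equiv.Perm (Fin n)) : ℕ :=
  ((Finset.Icc 1 n).filter fun i =>
    ∃ j ∈ Finset.Icc 1 n, i < j ∧ word π j = word π i + 1 ∧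
      ∀ k ∈ Finset.Icc 1 n, i < k → k < j → word π i + 1 < word π k).card

/-- number of peaks (with the boundary conventions `π(0)=π(n+1)=0`) -/
def pk {n : ℕ} (π : Equiv.Perm (Fin n)) : ℕ :=
  ((Finset.Icc 1 n).filter fun i => word π (i - 1) < word π i ∧ word π (i + 1) < word π i).card

/-- number of valleys -/
def valStat {n : ℕ} (π : Equiv.Perm (Fin n)) : ℕ :=
  ((Finset.Icc 1 n).filter fun i => word π i < word π (i - 1) ∧ word π i < word π (i + 1)).card

/-- number of double ascents -/
def dasc {n : ℕ} (π : Equiv.Perm (Fin n)) : ℕ :=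
  ((Finset.Icc 1 n).filter fun i => word π (i - 1) < word π i ∧ word π i < word π (i + 1)).card

/-- number of double descents -/
def ddes {n : ℕ} (π : Equiv.Perm (Fin n)) : ℕ :=
  ((Finset.Icc 1 n).filter fun i => word π (i + 1) < word π i ∧ word π i < word π (i - 1)).card

open Classical in
/-- `nextVal σ m x` is the (0-indexed) first value `≤ m` (i.e. `< m` in 0-indexed terms)
in the forward orbit of `x` under `σ`: it equals `σ^t(x)` for the minimal `t ≥ 1`
with `σ^t(x) < m`, when such `t` exists. This is the action of the permutation `σ_k`
(with `m = n - k`) obtained by removing the `k` largest letters from the cycles of `σ`. -/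
noncomputable def nextVal {n : ℕ} (σ : Equiv.Perm (Fin n)) (m : ℕ) (x : Fin n) : ℕ :=
  if h : ∃ t : ℕ, 0 < t ∧ (((σ ^ t) x : Fin n) : ℕ) < m then (((σ ^ Nat.find h) x : Fin n) : ℕ)
  else 0

/-- `σ` is a simsun permutation of the second kind: for every `0 ≤ k ≤ n-1`, the
permutation of `[n-k]` obtained from `σ` by removing the `k` largest letters has
no cycle double ascents. (Here `m = n - k` and values are 0-indexed.) -/
def IsSimsun2 {n : ℕ} (σ : Equiv.Perm (Fin n)) : Prop :=
  ∀ m ≤ n, ∀ x : Fin n, (x : ℕ) < m →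
    ¬ (nextVal σ⁻¹ m x < (x : ℕ) ∧ (x : ℕ) < nextVal σ m x)

noncomputable instance {n : ℕ} : DecidablePred (IsSimsun2 (n := n)) :=
  fun _ => Classical.propDecidable _

/-- the derangement polynomial `d_n(x)` -/
def dpoly (n : ℕ) (x : ℝ) : ℝ :=
  ∑ σ ∈ Finset.univ.filter fun σ : Equiv.Perm (Fin n) => fixStat σ = 0, x ^ excStat σ

/-- the Eulerian polynomial `A_n(x)` -/
def eulerian (n : ℕ) (x : ℝ) : ℝ :=
  ∑ π : Equiv.Perm (Fin n), x ^ des π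


open Equiv Equiv.Perm in
theorem cyc_split {α : Type*} [Fintype α] [DecidableEq α] (g : Perm α) (x : α) (hx : g x ≠ x) :
    (swap x (g x) * g).cycleType.card + (if g (g x) = x then 1 else 0) = g.cycleType.card := by
  classical
  set c := g.cycleOf x with hc
  have hcx : c x = g x := cycleOf_apply_self g x
  have hcc : c (g x) = g (g x) := cycleOf_apply_apply_self g x
  have hcyc : c.IsCycle := isCycle_cycleOf g hx
  have hmem : c ∈ g.cycleFactorsFinset := by
    rw [hc, cycleOf_mem_cycleFactorsFinset_iff, mem_support]; exact hx
  have hd := disjoint_mul_inv_of_mem_cycleFactorsFinset hmem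
  set r := g * c⁻¹ with hr
  have hg : g = c * r := by rw [← hd.commute.eq, hr]; simp
  have h1 : g.cycleType.card = 1 + r.cycleType.card := by
    rw [hg, hd.symm.cycleType_mul, Multiset.card_add, hcyc.cycleType]; simp
  have h2 : swap x (g x) * g = (swap x (c x) * c) * r := by
    rw [hcx, mul_assoc, ← hg]
  rw [h1, h2]
  split_ifs with h
  · have : c = swap x (c x) := hcyc.eq_swap_of_apply_apply_eq_self (by rw [hcx]; exact hx) (by rw [hcx, hcc, h])
    have h3 : swap x (c x) * c = 1 := by
      conv_lhs => rw [this]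
      simp
    rw [h3]; simp [add_comm]
  · have h' : c (c x) ≠ x := by rw [hcx, hcc]; exact h
    have hcy2 := hcyc.swap_mul (x := x) (by rw [hcx]; exact hx) h'
    have hdis : Disjoint (swap x (c x) * c) r := by
      rw [disjoint_iff_disjoint_support, support_swap_mul_eq _ _ h']
      exact Finset.disjoint_of_subset_left Finset.sdiff_subset (disjoint_iff_disjoint_support.1 hd.symm)
    rw [hdis.cycleType_mul, Multiset.card_add, hcy2.cycleType]; simp

open Equiv Equiv.Perm in
theorem dec_zero_cycleType {n : ℕ} (e : Perm (Fin n)) :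
    (decomposeFin.symm (0, e)).cycleType = e.cycleType := by
  have : decomposeFin.symm (0, e) = e.viaFintypeEmbedding (Fin.succEmb n) := by
    ext i
    refine Fin.cases ?_ (fun i => ?_) i
    · rw [viaFintypeEmbedding_apply_notMem_range]
      · simp
      · simp
    · have := viaFintypeEmbedding_apply_image e (Fin.succEmb n) i
      simp at this
      simp [this]
  rw [this, viaFintypeEmbedding, cycleType_extendDomain]

open Equiv Equiv.Perm in
theorem dec_eq {n : ℕ} (p : Fin (n+1)) (e : Perm (Fin n)) :
    decomposeFin.symm (0, e) = swap 0 p * decomposeFin.symm (p, e) := by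
  ext i
  refine Fin.cases ?_ (fun i => ?_) i <;> simp

open Equiv Equiv.Perm in
theorem dec_succ_card {n : ℕ} (y : Fin n) (e : Perm (Fin n)) :
    (decomposeFin.symm (y.succ, e)).cycleType.card
      = e.cycleType.card + if e y = y then 1 else 0 := by
  have h := cyc_split (decomposeFin.symm (y.succ, e)) 0 (by simp)
  rw [decomposeFin_symm_apply_zero, ← dec_eq, dec_zero_cycleType] at h
  rw [← h]
  congr 1
  simp only [decomposeFin_symm_apply_succ]
  by_cases hy : e y = y
  · simp [hy]
  · rw [swap_apply_of_ne_of_ne (by simp) (by simpa using hy)]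
    simp [hy]

theorem deriv_prod {ι R : Type*} [DecidableEq ι] [CommRing R] [Algebra ℝ R] (d : Derivation ℝ R R)
    (t : Finset ι) (w : ι → R) :
    d (∏ i ∈ t, w i) = ∑ i ∈ t, (∏ j ∈ t.erase i, w j) * d (w i) := by
  induction t using Finset.induction_on with
  | empty => simp
  | insert a t ha ih =>
    rw [Finset.prod_insert ha, Finset.sum_insert ha, d.leibniz, ih, Finset.erase_insert ha]
    simp only [smul_eq_mul, Finset.mul_sum]
    rw [add_comm]
    congr 1
    refine Finset.sum_congr rfl fun i hi => ?_
    rw [Finset.erase_insert_of_ne (by rintro rfl; exact ha hi), Finset.prod_insert (by simp [ha])]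
    ring

/-- cyclic weight -/
def cw {R : Type*} [CommRing R] (v f a b : R) (l m r : ℕ) : R :=
  if m < r then (if l < m then a else v) else if r = m then f else (if l < m then 1 else b)

/-- cyclic total weight -/
def CW {R : Type*} [CommRing R] (v f a b s : R) {n : ℕ} (e : Equiv.Perm (Fin n)) : R :=
  (∏ i, cw v f a b (e⁻¹ i : Fin n) (i : Fin n) (e i)) * (s + 1) ^ e.cycleType.card

theorem CW_zero {R : Type*} [CommRing R] (v f a b s : R) {n : ℕ} (e : Equiv.Perm (Fin n)) :
    CW v f a b s (Equiv.Perm.decomposeFin.symm (0, e)) = f * CW v f a b s e := by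
  unfold CW
  rw [dec_zero_cycleType, Fin.prod_univ_succ]
  have h1 : ∀ i : Fin n, (Equiv.Perm.decomposeFin.symm (0, e))⁻¹ i.succ = (e⁻¹ i).succ := by
    intro i; rw [Equiv.Perm.inv_eq_iff_eq]; simp
  have h0 : cw v f a b ((Equiv.Perm.decomposeFin.symm (0, e))⁻¹ 0 : Fin (n+1)) (0 : Fin (n+1))
      ((Equiv.Perm.decomposeFin.symm (0, e)) 0) = f := by simp [cw]
  rw [h0, mul_assoc]
  congr 2
  refine Finset.prod_congr rfl fun i _ => ?_
  rw [h1]; simp [cw]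

theorem CW_succ {R : Type*} [CommRing R] (v f a b s : R) {n : ℕ} (e : Equiv.Perm (Fin n))
    (y : Fin n) :
    CW v f a b s (Equiv.Perm.decomposeFin.symm (y.succ, e)) = v *
      (∏ i : Fin n, cw v f a b (if i = y then 0 else (e⁻¹ i : Fin n) + 1) (i + 1)
        (if e i = y then 0 else (e i : ℕ) + 1)) * (s+1)^(if e y = y then 1 else 0) *
        (s + 1) ^ e.cycleType.card := by
  unfold CW
  rw [dec_succ_card, Fin.prod_univ_succ]
  have h0 : ((Equiv.Perm.decomposeFin.symm (y.succ, e))⁻¹ 0) = (e⁻¹ y).succ := by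
    rw [Equiv.Perm.inv_eq_iff_eq]; simp
  have h1 : ∀ i : Fin n, (Equiv.Perm.decomposeFin.symm (y.succ, e))⁻¹ i.succ =
      if i = y then 0 else (e⁻¹ i).succ := by
    intro i; rw [Equiv.Perm.inv_eq_iff_eq]
    split_ifs with h
    · simp [h]
    · simp; rw [Equiv.swap_apply_of_ne_of_ne (by simp) (by simpa using h)]
  have h2 : ∀ i : Fin n, (Equiv.Perm.decomposeFin.symm (y.succ, e)) i.succ =
      if e i = y then 0 else (e i).succ := by
    intro i
    split_ifs with h
    · simp [h]
    · simp; rw [Equiv.swap_apply_of_ne_of_ne (by simp) (by simpa using h)]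
  have h3 : cw v f a b ((Equiv.Perm.decomposeFin.symm (y.succ, e))⁻¹ 0 : Fin (n+1)) (0 : Fin (n+1))
      ((Equiv.Perm.decomposeFin.symm (y.succ, e)) 0) = v := by simp [cw]
  rw [h3, pow_add]
  have h4 : ∀ i : Fin n, cw v f a b ((Equiv.Perm.decomposeFin.symm (y.succ, e))⁻¹ i.succ : Fin (n+1))
      (i.succ : Fin (n+1)) ((Equiv.Perm.decomposeFin.symm (y.succ, e)) i.succ) =
      cw v f a b (if i = y then 0 else (e⁻¹ i : Fin n) + 1) (i + 1)
        (if e i = y then 0 else (e i : ℕ) + 1) := by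
    intro i
    rw [h1, h2]
    congr 1 <;> split_ifs <;> simp
  simp only [h4]
  ring

theorem CW_rec {R : Type*} [CommRing R] [Algebra ℝ R] (d : Derivation ℝ R R) (v f a b s : R)
    (hv : d v = v * (a + b)) (hf : d f = (s + 1) * v) (ha : d a = v) (hb : d b = v) (hs : d s = 0)
    {n : ℕ} (e : Equiv.Perm (Fin n)) :
    ∑ p, CW v f a b s (Equiv.Perm.decomposeFin.symm (p, e)) =
      f * CW v f a b s e + d (CW v f a b s e) := by
  rw [Fin.sum_univ_succ, CW_zero]
  congr 1
  have hT : d ((s + 1) ^ e.cycleType.card) = 0 := by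
    rw [d.leibniz_pow, map_add, hs]; simp
  set w : Fin n → R := fun i => cw v f a b (e⁻¹ i : Fin n) (i : Fin n) (e i) with hw
  have hd : d (CW v f a b s e) = (∑ i, (∏ j ∈ univ.erase i, w j) * d (w i)) *
      (s + 1) ^ e.cycleType.card := by
    rw [CW, d.leibniz, hT, deriv_prod]; simp [mul_comm, hw]
  rw [hd]
  simp only [CW_succ]
  rw [← Finset.sum_mul]
  congr 1
  set N : Fin n → Fin n → R := fun y i => cw v f a b (if i = y then 0 else (e⁻¹ i : Fin n) + 1) (i + 1)
        (if e i = y then 0 else (e i : ℕ) + 1) with hN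
  set t : Fin n → R := fun y => v * (∏ i, N y i) * (s+1)^(if e y = y then 1 else 0) with ht
  change ∑ y, t y = _
  have hsplit : ∑ y, t y = ∑ x, ((if x < e x then t (e x) else 0) +
      (if e⁻¹ x < x then 0 else t x)) := by
    rw [Finset.sum_add_distrib]
    have : ∑ x, (if x < e x then t (e x) else 0) = ∑ y, (if e⁻¹ y < y then t y else 0) := by
      rw [← Equiv.sum_comp e (fun y => (if e⁻¹ y < y then t y else 0))]
      simp
    rw [this, ← Finset.sum_add_distrib]
    refine Finset.sum_congr rfl fun y _ => ?_
    split_ifs <;> simp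
  rw [hsplit]
  refine Finset.sum_congr rfl fun x _ => ?_
  -- t evaluations
  have hother : ∀ y i : Fin n, i ≠ y → e i ≠ y → N y i = w i := by
    intro y i h1 h2
    simp [hN, hw, cw, h1, h2]
  have hA : x < e x → t (e x) = (∏ j ∈ univ.erase x, w j) *
      (v * N (e x) x * (s+1)^(if e (e x) = e x then 1 else 0)) := by
    intro hx
    simp only [ht]
    rw [← Finset.mul_prod_erase univ _ (mem_univ x)]
    have : ∏ i ∈ univ.erase x, N (e x) i = ∏ i ∈ univ.erase x, w i := by
      refine Finset.prod_congr rfl fun i hi => ?_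
      have hix : i ≠ x := Finset.ne_of_mem_erase hi
      by_cases h : i = e x
      · subst h
        simp [hN, hw, cw, hix]
        have : (x : ℕ) < (e x : Fin n) := hx
        simp [hx]
      · exact hother _ _ h (fun h' => hix (e.injective h'))
    rw [this]; ring
  have hB : ¬ (e⁻¹ x < x) → t x = (∏ j ∈ univ.erase x, w j) *
      (v * N x x * (s+1)^(if e x = x then 1 else 0)) := by
    intro hx
    simp only [ht]
    rw [← Finset.mul_prod_erase univ _ (mem_univ x)]
    have : ∏ i ∈ univ.erase x, N x i = ∏ i ∈ univ.erase x, w i := by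
      refine Finset.prod_congr rfl fun i hi => ?_
      have hix : i ≠ x := Finset.ne_of_mem_erase hi
      by_cases h : e i = x
      · subst h
        simp at hx
        have hlt : (e i : Fin n) < i := lt_of_le_of_ne hx (fun h => hix h.symm)
        have h3 : ¬ (i < e i) := not_lt.2 hx
        simp [hN, hw, cw, hix, h3]
        have : ¬ (e i = i) := fun h => hix h.symm
        simp [Fin.ext_iff] at this
        simp [this]
      · exact hother _ _ hix h
    rw [this]; ring
  rcases lt_trichotomy x (e x) with h | h | h
  · have h0 : e x ≠ x := h.ne'
    have h0' : (e (e x)) ≠ e x := fun h' => h0 (e.injective h')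
    have hv1 : (x : ℕ) < (e x : Fin n) := h
    rw [if_pos h, hA h]
    by_cases h2 : e⁻¹ x < x
    · have h3 : e.symm x < x := h2
      have : w x = a := by simp [hw, cw, h, h3]
      rw [if_pos h2, this, ha]
      have : N (e x) x = 1 := by simp [hN, cw, h0.symm, h3]
      rw [this]; simp [h0']
    · have h3 : ¬ e.symm x < x := h2
      have : w x = v := by simp [hw, cw, h, h3]
      rw [if_neg h2, this, hv, hB h2]
      have : N (e x) x = b := by simp [hN, cw, h0.symm, h3]
      have h5 : N x x = a := by simp [hN, cw, h0, h]
      rw [this, h5]; simp [h0, h0']; ring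
  · have h1 : e⁻¹ x = x := by rw [Equiv.Perm.inv_eq_iff_eq]; exact h
    have : w x = f := by simp [hw, cw, ← h]
    rw [if_neg (by simp [← h]), if_neg (by simp [h1]), hB (by simp [h1]), this, hf]
    have : N x x = 1 := by simp [hN, cw, ← h]
    rw [this]; simp [← h]; ring
  · have h0 : e x ≠ x := h.ne
    have hv0 : (e x : ℕ) ≠ (x : ℕ) := fun h' => h0 (Fin.ext h')
    have hnl : ¬ (x < e x) := not_lt.2 h.le
    rw [if_neg hnl]
    by_cases h2 : e⁻¹ x < x
    · have h3 : e.symm x < x := h2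
      have : w x = 1 := by simp [hw, cw, hnl, h3, hv0]
      rw [if_pos h2, this]; simp
    · have h3 : ¬ e.symm x < x := h2
      have : w x = b := by simp [hw, cw, hnl, h3, hv0]
      rw [if_neg h2, this, hb, hB h2]
      have : N x x = 1 := by simp [hN, cw, h0, hnl, hv0]
      rw [this]; simp [h0]

/-- insertion of a value at position `p` -/
def ins (p M : ℕ) (u : ℕ → ℕ) (i : ℕ) : ℕ := if i < p then u i else if i = p then M else u (i - 1)

/-- shift of positions -/
def sh (p j : ℕ) : ℕ := if j < p then j else j + 1

theorem Icc_sh {m p : ℕ} (hp : p ∈ Icc 1 (m + 1)) :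
    Icc 1 (m + 1) = insert p ((Icc 1 m).image (sh p)) := by
  ext i
  simp only [mem_insert, mem_image, mem_Icc, sh] at *
  constructor
  · intro hi
    rcases lt_trichotomy i p with h | h | h
    · right; exact ⟨i, by omega, by simp [h]⟩
    · left; exact h
    · right; refine ⟨i - 1, by omega, ?_⟩
      split_ifs <;> omega
  · rintro (h | ⟨j, hj, rfl⟩)
    · omega
    · split_ifs <;> omega

theorem prod_sh {R : Type*} [CommMonoid R] {m p : ℕ} (hp : p ∈ Icc 1 (m + 1)) (g : ℕ → R) :
    ∏ i ∈ Icc 1 (m + 1), g i = g p * ∏ j ∈ Icc 1 m, g (sh p j) := by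
  rw [Icc_sh hp, Finset.prod_insert, Finset.prod_image]
  · intro a _ b _ h
    simp only [sh] at h
    split_ifs at h <;> omega
  · simp only [mem_image, sh, not_exists, not_and]
    intro a _ h
    split_ifs at h <;> omega

theorem sum_sh {R : Type*} [AddCommMonoid R] {m p : ℕ} (hp : p ∈ Icc 1 (m + 1)) (g : ℕ → R) :
    ∑ i ∈ Icc 1 (m + 1), g i = g p + ∑ j ∈ Icc 1 m, g (sh p j) :=
  prod_sh (R := Multiplicative R) hp g

theorem ins_sh (p M : ℕ) (u : ℕ → ℕ) (j : ℕ) : ins p M u (sh p j) = u j := by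
  simp only [ins, sh]
  split_ifs <;> first | omega | rfl

theorem ins_self (p M : ℕ) (u : ℕ → ℕ) : ins p M u p = M := by
  simp [ins]

/-- linear weight -/
def lw {R : Type*} (x1 x2 x3 x4 : R) (l c r : ℕ) : R :=
  if l < c then (if r < c then x1 else x3) else (if r < c then x4 else x2)

/-- simsun succession at position `i` -/
def SS (u : ℕ → ℕ) (m i : ℕ) : Prop :=
  ∃ j ∈ Icc 1 m, i < j ∧ u j = u i + 1 ∧ ∀ k ∈ Icc 1 m, i < k → k < j → u i + 1 < u k

open Classical in
/-- linear total weight -/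
noncomputable def LW {R : Type*} [CommRing R] (x1 x2 x3 x4 s : R) (u : ℕ → ℕ) (m : ℕ) : R :=
  (∏ i ∈ Icc 1 m, lw x1 x2 x3 x4 (u (i - 1)) (u i) (u (i + 1))) *
    ∏ i ∈ Icc 1 m, if SS u m i then s else 1

/-- valid words -/
structure Valid (u : ℕ → ℕ) (m : ℕ) : Prop where
  z : u 0 = 0
  e : u (m + 1) = 0
  pos : ∀ i ∈ Icc 1 m, 1 ≤ u i
  le : ∀ i, u i ≤ m
  inj : ∀ i ∈ Icc 1 m, ∀ j ∈ Icc 1 m, u i = u j → i = j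
  mx : 1 ≤ m → ∃ q ∈ Icc 1 m, u q = m

theorem Valid.ne {u : ℕ → ℕ} {m : ℕ} (h : Valid u m) (hm : 1 ≤ m) {p : ℕ} (hp : p ∈ Icc 1 (m + 1)) :
    u (p - 1) ≠ u p := by
  simp only [mem_Icc] at hp
  intro he
  by_cases h1 : p = 1
  · subst h1
    have := h.pos 1 (by simp [hm])
    have := h.z
    simp at he
    omega
  by_cases h2 : p = m + 1
  · subst h2
    have := h.pos m (by simp [hm])
    have := h.e
    simp at he
    omega
  have := h.inj (p - 1) (by simp; omega) p (by simp; omega) he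
  omega

theorem SS_ins {u : ℕ → ℕ} {m : ℕ} (h : Valid u m) {p : ℕ} (hp : p ∈ Icc 1 (m + 1))
    {j : ℕ} (hj : j ∈ Icc 1 m) :
    SS (ins p (m + 1) u) (m + 1) (sh p j) ↔ SS u m j ∨ (u j = m ∧ j + 1 = p) := by
  have hmono : ∀ a b, sh p a < sh p b ↔ a < b := by
    intro a b; simp only [sh]; split_ifs <;> omega
  have hmem : ∀ i, i ∈ Icc 1 (m + 1) ↔ i = p ∨ ∃ a ∈ Icc 1 m, sh p a = i := by
    intro i; rw [Icc_sh hp]; simp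
  simp only [SS, ins_sh]
  constructor
  · rintro ⟨j', hj', hlt, he, hk⟩
    rcases (hmem j').1 hj' with rfl | ⟨a, ha, rfl⟩
    · right
      rw [ins_self] at he
      refine ⟨by omega, ?_⟩
      by_contra hne
      have hjp : j < j' := by
        simp only [sh] at hlt; split_ifs at hlt <;> omega
      have hs : sh j' (j + 1) = j + 1 := by simp only [sh]; split_ifs <;> omega
      simp only [mem_Icc] at hp hj
      have := hk (sh j' (j + 1)) (by rw [hs]; simp; omega) ((hmono _ _).2 (by omega)) (by omega)
      rw [ins_sh] at this
      have := h.le (j + 1)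
      omega
    · left
      rw [ins_sh] at he
      refine ⟨a, ha, (hmono _ _).1 hlt, he, fun k hk' h1 h2 => ?_⟩
      have := hk (sh p k) ((hmem _).2 (Or.inr ⟨k, hk', rfl⟩)) ((hmono _ _).2 h1) ((hmono _ _).2 h2)
      rwa [ins_sh] at this
  · rintro (⟨a, ha, hlt, he, hk⟩ | ⟨h1, h2⟩)
    · refine ⟨sh p a, (hmem _).2 (Or.inr ⟨a, ha, rfl⟩), (hmono _ _).2 hlt, by rw [ins_sh]; exact he, ?_⟩
      intro k hk' h1 h2
      rcases (hmem k).1 hk' with rfl | ⟨b, hb, rfl⟩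
      · rw [ins_self]; have := h.le a; omega
      · rw [ins_sh]; exact hk b hb ((hmono _ _).1 h1) ((hmono _ _).1 h2)
    · refine ⟨p, hp, by simp only [sh]; split_ifs <;> omega, by rw [ins_self]; omega, ?_⟩
      intro k hk' h3 h4
      simp only [sh] at h3
      split_ifs at h3 <;> omega

theorem LW_ins {R : Type*} [CommRing R] (x1 x2 x3 x4 s : R) {u : ℕ → ℕ} {m : ℕ} (h : Valid u m)
    {p : ℕ} (hp : p ∈ Icc 1 (m + 1)) {q : ℕ} (hq : q ∈ Icc 1 m) (huq : u q = m) :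
    LW x1 x2 x3 x4 s (ins p (m + 1) u) (m + 1) =
      x1 * (∏ j ∈ Icc 1 m, lw x1 x2 x3 x4 (if j = p then m + 1 else u (j - 1)) (u j)
        (if j + 1 = p then m + 1 else u (j + 1))) * (if q + 1 = p then s else 1) *
        (∏ i ∈ Icc 1 m, open Classical in if SS u m i then s else 1) := by
  classical
  have hp' := mem_Icc.1 hp
  unfold LW
  rw [prod_sh hp, prod_sh hp]
  have h1 : lw x1 x2 x3 x4 (ins p (m + 1) u (p - 1)) (ins p (m + 1) u p) (ins p (m + 1) u (p + 1))
      = x1 := by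
    have ha : ins p (m + 1) u (p - 1) = u (p - 1) := by
      simp only [ins]; rw [if_pos (by omega)]
    have hb : ins p (m + 1) u (p + 1) = u p := by simp [ins]
    have := h.le (p - 1)
    have := h.le p
    rw [ha, hb, ins_self, lw, if_pos (by omega), if_pos (by omega)]
  have h2 : ¬ SS (ins p (m + 1) u) (m + 1) p := by
    rintro ⟨j, hj, hlt, he, -⟩
    rw [ins_self] at he
    have h3 : ins p (m + 1) u j = u (j - 1) := by
      simp only [ins]; rw [if_neg (by omega), if_neg (by omega)]
    have := h.le (j - 1)
    omega
  have h3 : ∏ j ∈ Icc 1 m, lw x1 x2 x3 x4 (ins p (m + 1) u (sh p j - 1)) (ins p (m + 1) u (sh p j))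
      (ins p (m + 1) u (sh p j + 1)) = ∏ j ∈ Icc 1 m, lw x1 x2 x3 x4
        (if j = p then m + 1 else u (j - 1)) (u j) (if j + 1 = p then m + 1 else u (j + 1)) := by
    refine Finset.prod_congr rfl fun j hj => ?_
    rw [mem_Icc] at hj
    rw [ins_sh]
    congr 1
    · simp only [ins, sh]
      split_ifs <;> first | omega | rfl
    · simp only [ins, sh]
      split_ifs <;> first | omega | rfl
  have h4 : (∏ j ∈ Icc 1 m, if SS (ins p (m + 1) u) (m + 1) (sh p j) then s else 1) =
      (if q + 1 = p then s else 1) * ∏ i ∈ Icc 1 m, if SS u m i then s else 1 := by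
    have hnq : ¬ SS u m q := by
      rintro ⟨j, hj, hlt, he, -⟩
      have := h.le j
      omega
    rw [← Finset.mul_prod_erase _ _ hq,
      ← Finset.mul_prod_erase (Icc 1 m) (fun i => if SS u m i then s else 1) hq]
    simp only [SS_ins h hp hq, hnq, huq, false_or, true_and, if_false, one_mul]
    congr 1
    refine Finset.prod_congr rfl fun j hj => ?_
    have hj1 := Finset.mem_of_mem_erase hj
    have hj2 := Finset.ne_of_mem_erase hj
    have : u j ≠ m := fun h' => hj2 (h.inj _ hj1 _ hq (by omega))
    simp [SS_ins h hp hj1, this]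
  rw [h1, h3, h4, if_neg h2]
  ring

theorem LW_rec {R : Type*} [CommRing R] [Algebra ℝ R] (d : Derivation ℝ R R) (x1 x2 x3 x4 s : R)
    (h1 : d x1 = x1 * (x3 + x4)) (h2 : d x2 = 0) (h3 : d x3 = x1 * x2) (h4 : d x4 = x1 * x2)
    (hs : d s = 0) {u : ℕ → ℕ} {m : ℕ} (h : Valid u m) (hm : 1 ≤ m) :
    ∑ p ∈ Icc 1 (m + 1), LW x1 x2 x3 x4 s (ins p (m + 1) u) (m + 1) =
      d (LW x1 x2 x3 x4 s u m) + (s - 1) * x3 * LW x1 x2 x3 x4 s u m := by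
  classical
  obtain ⟨q, hq, huq⟩ := h.mx hm
  rw [Finset.sum_congr rfl fun p hp => LW_ins x1 x2 x3 x4 s h hp hq huq, ← Finset.sum_mul]
  set S : R := ∏ i ∈ Icc 1 m, if SS u m i then s else 1 with hS
  have hdS : d S = 0 := by
    rw [hS, deriv_prod]
    refine Finset.sum_eq_zero fun i _ => ?_
    split_ifs <;> simp [hs]
  set w : ℕ → R := fun i => lw x1 x2 x3 x4 (u (i - 1)) (u i) (u (i + 1)) with hw
  have hL : LW x1 x2 x3 x4 s u m = (∏ i ∈ Icc 1 m, w i) * S := rfl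
  have hd : d (LW x1 x2 x3 x4 s u m) =
      (∑ i ∈ Icc 1 m, (∏ j ∈ (Icc 1 m).erase i, w j) * d (w i)) * S := by
    rw [hL, d.leibniz, hdS, deriv_prod]; simp [mul_comm]
  rw [hd, hL, ← mul_assoc, ← add_mul]
  congr 1
  set N : ℕ → ℕ → R := fun p j => lw x1 x2 x3 x4 (if j = p then m + 1 else u (j - 1)) (u j)
        (if j + 1 = p then m + 1 else u (j + 1)) with hN
  set t : ℕ → R := fun p => x1 * (∏ j ∈ Icc 1 m, N p j) * (if q + 1 = p then s else 1) with ht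
  change ∑ p ∈ Icc 1 (m + 1), t p = _
  have hsplit : ∑ p ∈ Icc 1 (m + 1), t p = ∑ j ∈ Icc 1 m,
      ((if u (j - 1) < u j then t j else 0) + (if u (j + 1) < u j then t (j + 1) else 0)) := by
    have e1 : ∑ p ∈ Icc 1 (m + 1), t p = ∑ p ∈ Icc 1 (m + 1), (if u (p - 1) < u p then t p else 0) +
        ∑ p ∈ Icc 1 (m + 1), (if u p < u (p - 1) then t p else 0) := by
      rw [← Finset.sum_add_distrib]
      refine Finset.sum_congr rfl fun p hp => ?_
      have := h.ne hm hp
      rcases lt_or_gt_of_ne this with h' | h'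
      · simp [h', h'.le]
      · simp [h', h'.le]
    rw [e1, Finset.sum_add_distrib]
    congr 1
    · rw [sum_sh (p := m + 1) (by simp)]
      rw [if_neg (by simp [h.e]), zero_add]
      refine Finset.sum_congr rfl fun j hj => ?_
      rw [mem_Icc] at hj
      rw [show sh (m + 1) j = j by simp only [sh]; rw [if_pos (by omega)]]
    · rw [sum_sh (p := 1) (by simp)]
      rw [if_neg (by simp [h.z]), zero_add]
      refine Finset.sum_congr rfl fun j hj => ?_
      rw [mem_Icc] at hj
      rw [show sh 1 j = j + 1 by simp only [sh]; rw [if_neg (by omega)]]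
      simp
  have hend : (s - 1) * x3 * ∏ i ∈ Icc 1 m, w i = ∑ j ∈ Icc 1 m,
      if j = q then (s - 1) * x3 * w j * (∏ i ∈ (Icc 1 m).erase j, w i) else 0 := by
    rw [Finset.sum_ite_eq' (Icc 1 m) q, if_pos hq, ← Finset.mul_prod_erase _ _ hq]
    ring
  rw [hsplit, hend, ← Finset.sum_add_distrib]
  refine Finset.sum_congr rfl fun j hj => ?_
  have hj' := mem_Icc.1 hj
  have huj := h.le j
  have hA : u (j - 1) < u j → t j = (∏ i ∈ (Icc 1 m).erase j, w i) * (x1 * N j j) := by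
    intro hlt
    simp only [ht]
    have : ¬ (q + 1 = j) := by
      rintro rfl
      simp at hlt; omega
    rw [if_neg this, ← Finset.mul_prod_erase _ _ hj]
    have : ∏ i ∈ (Icc 1 m).erase j, N j i = ∏ i ∈ (Icc 1 m).erase j, w i := by
      refine Finset.prod_congr rfl fun i hi => ?_
      have hij := Finset.ne_of_mem_erase hi
      have hui := h.le i
      by_cases hc : i + 1 = j
      · subst hc
        simp at hlt
        simp [hN, hw, lw, hlt.le.not_gt, (show ¬ (m + 1 < u i) by omega)]
      · simp [hN, hw, hij, hc]
    rw [this]; ring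
  have hB : u (j + 1) < u j → t (j + 1) = (∏ i ∈ (Icc 1 m).erase j, w i) *
      (x1 * N (j + 1) j * if j = q then s else 1) := by
    intro hlt
    simp only [ht]
    have : (q + 1 = j + 1) = (j = q) := by
      apply propext; omega
    rw [← Finset.mul_prod_erase _ _ hj]
    have : ∏ i ∈ (Icc 1 m).erase j, N (j + 1) i = ∏ i ∈ (Icc 1 m).erase j, w i := by
      refine Finset.prod_congr rfl fun i hi => ?_
      have hij := Finset.ne_of_mem_erase hi
      have hui := h.le i
      by_cases hc : i = j + 1
      · subst hc
        simp [hN, hw, lw, hlt.le.not_gt, (show ¬ (m + 1 < u (j + 1)) by have := h.le (j + 1); omega)]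
      · simp [hN, hw, hij, hc]
    rw [this]; simp only [*]; ring
  have hn1 := h.ne hm (p := j) (by simp; omega)
  have hn2 := h.ne hm (p := j + 1) (by simp; omega)
  simp only [Nat.add_sub_cancel] at hn2
  have hM : ¬ (m + 1 < u j) := by omega
  have hqpk : j = q → u (j - 1) < u j ∧ u (j + 1) < u j := by
    rintro rfl
    have := h.le (j - 1)
    have := h.le (j + 1)
    omega
  have hN1 : N j j = if u (j + 1) < u j then x4 else x2 := by
    simp [hN, lw, hM]
  have hN2 : N (j + 1) j = if u (j - 1) < u j then x3 else x2 := by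
    simp [hN, lw, hM]
  have hwj : w j = lw x1 x2 x3 x4 (u (j - 1)) (u j) (u (j + 1)) := rfl
  by_cases ha : u (j - 1) < u j <;> by_cases hb : u (j + 1) < u j
  · simp only [lw, if_pos ha, if_pos hb] at hwj hN1 hN2 ⊢
    rw [hA ha, hB hb, hwj, h1, hN1, hN2]
    split_ifs <;> ring
  · have hjq : j ≠ q := fun h' => hb (hqpk h').2
    simp only [lw, if_pos ha, if_neg hb] at hwj hN1 hN2 ⊢
    rw [hA ha, hwj, h3, hN1, if_neg hjq]
  · have hjq : j ≠ q := fun h' => ha (hqpk h').1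
    simp only [lw, if_neg ha, if_pos hb] at hwj hN1 hN2 ⊢
    rw [hB hb, hwj, h4, hN2, if_neg hjq, if_neg hjq]
    ring
  · have hjq : j ≠ q := fun h' => ha (hqpk h').1
    simp only [lw, if_neg ha, if_neg hb] at hwj ⊢
    rw [hwj, h2, if_neg hjq]
    simp

theorem pow_card_eq {R : Type*} [CommMonoid R] {ι : Type*} (t : Finset ι) (P : ι → Prop)
    [DecidablePred P] (a : R) : a ^ (t.filter P).card = ∏ i ∈ t, if P i then a else 1 := by
  rw [← Finset.prod_filter, Finset.prod_const]

theorem word_valid {n : ℕ} (π : Equiv.Perm (Fin n)) : Valid (word π) n where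
  z := by simp [word]
  e := by simp [word]
  pos := by
    intro i hi
    rw [mem_Icc] at hi
    simp [word, hi]
  le := by
    intro i
    unfold word
    split_ifs with h
    · exact (π _).2
    · omega
  inj := by
    intro i hi j hj h
    rw [mem_Icc] at hi hj
    simp only [word, hi, hj, and_self, dif_pos, Nat.add_right_cancel_iff] at h
    have := π.injective (Fin.ext h)
    simp at this
    omega
  mx := by
    intro hm
    refine ⟨(π.symm ⟨n - 1, by omega⟩ : Fin n) + 1, ?_, ?_⟩
    · rw [mem_Icc]; have := (π.symm ⟨n - 1, by omega⟩ : Fin n).2; omega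
    · have := (π.symm ⟨n - 1, by omega⟩ : Fin n).2
      rw [word, dif_pos (by omega)]
      simp; omega

theorem LW_word {R : Type*} [CommRing R] (x1 x2 x3 x4 s : R) {n : ℕ} (hn : 1 ≤ n)
    (π : Equiv.Perm (Fin n)) :
    LW x1 x2 x3 x4 s (word π) n =
      x1 ^ pk π * x2 ^ valStat π * x3 ^ dasc π * x4 ^ ddes π * s ^ simsuc π := by
  classical
  unfold LW pk valStat dasc ddes simsuc
  simp only [pow_card_eq]
  have key : ∀ A B C D : R, A = B → C = D → A * C = B * D := by
    rintro A B C D rfl rfl; rfl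
  refine key _ _ _ _ ?_ (Finset.prod_congr rfl fun i _ => rfl)
  rw [← Finset.prod_mul_distrib, ← Finset.prod_mul_distrib, ← Finset.prod_mul_distrib]
  refine Finset.prod_congr rfl fun i hi => ?_
  rw [mem_Icc] at hi
  have h1 := (word_valid π).ne hn (p := i) (by simp; omega)
  have h2 := (word_valid π).ne hn (p := i + 1) (by simp; omega)
  simp only [Nat.add_sub_cancel] at h2
  by_cases ha : word π (i - 1) < word π i <;> by_cases hb : word π (i + 1) < word π i
  · simp [lw, ha, hb, ha.not_gt, hb.not_gt]
  · have hb' : word π i < word π (i + 1) := by omega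
    simp [lw, ha, hb, hb', ha.not_gt]
  · have ha' : word π i < word π (i - 1) := by omega
    simp [lw, ha, hb, ha', hb.not_gt]
  · have hb' : word π i < word π (i + 1) := by omega
    have ha' : word π i < word π (i - 1) := by omega
    simp [lw, ha, hb, ha', hb']

/-- insertion of the largest letter -/
def insPerm {n : ℕ} (p : Fin (n + 1)) (π : Equiv.Perm (Fin n)) : Equiv.Perm (Fin (n + 1)) :=
  ((finSuccEquiv' p).trans (Equiv.optionCongr π)).trans (finSuccEquiv' (Fin.last n)).symm

theorem insPerm_self {n : ℕ} (p : Fin (n + 1)) (π : Equiv.Perm (Fin n)) :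
    insPerm p π p = Fin.last n := by
  simp [insPerm]

theorem insPerm_succAbove {n : ℕ} (p : Fin (n + 1)) (π : Equiv.Perm (Fin n)) (j : Fin n) :
    insPerm p π (p.succAbove j) = (π j).castSucc := by
  simp [insPerm]

theorem insPerm_bij {n : ℕ} : Function.Bijective
    (fun x : Fin (n + 1) × Equiv.Perm (Fin n) => insPerm x.1 x.2) := by
  rw [Fintype.bijective_iff_injective_and_card]
  constructor
  · rintro ⟨p, π⟩ ⟨p', π'⟩ h
    simp only at h
    have hp : p = p' := by
      have h1 := insPerm_self p π
      rw [h, ← insPerm_self p' π'] at h1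
      exact (insPerm p' π').injective h1
    subst hp
    congr 1
    ext j
    have := insPerm_succAbove p π j
    rw [h, insPerm_succAbove] at this
    have := congrArg Fin.val this
    simp at this
    exact this.symm ▸ rfl
  · simp [Fintype.card_perm, Nat.factorial_succ]

theorem word_insPerm {n : ℕ} (p : Fin (n + 1)) (π : Equiv.Perm (Fin n)) :
    word (insPerm p π) = ins (p + 1) (n + 1) (word π) := by
  funext i
  by_cases hi : 1 ≤ i ∧ i ≤ n + 1
  · rw [word, dif_pos hi]
    rcases Fin.eq_self_or_eq_succAbove p ⟨i - 1, by omega⟩ with h | ⟨j, h⟩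
    · rw [h, insPerm_self]
      have : (p : ℕ) = i - 1 := by rw [← h]
      have : i = p + 1 := by omega
      rw [this, ins_self]; simp
    · have hv : i = sh (p + 1) (j + 1) := by
        have := congrArg Fin.val h
        simp only [Fin.succAbove, Fin.lt_def] at this
        simp only [sh]
        split_ifs at this ⊢ <;> simp at * <;> omega
      rw [h, insPerm_succAbove]
      conv_rhs => rw [hv, ins_sh, word, dif_pos (by omega)]
      simp
  · rw [word, dif_neg hi]
    have := p.2
    simp only [ins, word]
    split_ifs <;> omega

/-- common polynomial derivation -/
noncomputable def DQ : Derivation ℝ (MvPolynomial (Fin 4) ℝ) (MvPolynomial (Fin 4) ℝ) :=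
  MvPolynomial.mkDerivation ℝ ![MvPolynomial.X 0 * MvPolynomial.X 2,
    (MvPolynomial.X 3 + 1) * MvPolynomial.X 0, 2 * MvPolynomial.X 0, 0]

/-- common polynomials -/
noncomputable def Q : ℕ → MvPolynomial (Fin 4) ℝ
  | 0 => 1
  | n + 1 => MvPolynomial.X 1 * Q n + DQ (Q n)

theorem aeval_DQ {R : Type*} [CommRing R] [Algebra ℝ R] (d : Derivation ℝ R R) (y : Fin 4 → R)
    (h0 : d (y 0) = y 0 * y 2) (h1 : d (y 1) = (y 3 + 1) * y 0) (h2 : d (y 2) = 2 * y 0)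
    (h3 : d (y 3) = 0) (p : MvPolynomial (Fin 4) ℝ) :
    d (MvPolynomial.aeval y p) = MvPolynomial.aeval y (DQ p) := by
  induction p using MvPolynomial.induction_on with
  | C a => simp [DQ]
  | add p q hp hq => simp [hp, hq]
  | mul_X p i hp =>
    have hX : d (y i) = MvPolynomial.aeval y (DQ (MvPolynomial.X i)) := by
      simp only [DQ, MvPolynomial.mkDerivation_X]
      fin_cases i
      · simpa using h0
      · simpa using h1
      · simpa using h2
      · simpa using h3
    rw [map_mul, MvPolynomial.aeval_X, d.leibniz, DQ.leibniz, hp, hX]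
    simp

theorem LW_sum {R : Type*} [CommRing R] [Algebra ℝ R] (d : Derivation ℝ R R) (x1 x2 x3 x4 s : R)
    (h1 : d x1 = x1 * (x3 + x4)) (h2 : d x2 = 0) (h3 : d x3 = x1 * x2) (h4 : d x4 = x1 * x2)
    (hs : d s = 0) (n : ℕ) :
    ∑ π : Equiv.Perm (Fin (n + 1)), LW x1 x2 x3 x4 s (word π) (n + 1) =
      x1 * MvPolynomial.aeval ![x1 * x2, s * x3 + x4, x3 + x4, s] (Q n) := by
  induction n with
  | zero =>
    have hw : ∀ π : Equiv.Perm (Fin 1), LW x1 x2 x3 x4 s (word π) 1 = x1 := by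
      intro π
      have : ¬ SS (word π) 1 1 := by
        rintro ⟨j, hj, hlt, -⟩
        simp at hj; omega
      simp [LW, lw, this, word]
    simp [hw, Q]
  | succ n ih =>
    rw [← insPerm_bij.sum_comp, Fintype.sum_prod_type, Finset.sum_comm]
    have e1 : ∀ π : Equiv.Perm (Fin (n + 1)), ∑ p : Fin (n + 2),
        LW x1 x2 x3 x4 s (word (insPerm p π)) (n + 2) =
        d (LW x1 x2 x3 x4 s (word π) (n + 1)) + (s - 1) * x3 * LW x1 x2 x3 x4 s (word π) (n + 1) := by
      intro π
      rw [← LW_rec d x1 x2 x3 x4 s h1 h2 h3 h4 hs (word_valid π) (by omega)]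
      simp only [word_insPerm]
      rw [Fin.sum_univ_eq_sum_range
        (fun p => LW x1 x2 x3 x4 s (ins (p + 1) (n + 1 + 1) (word π)) (n + 2)) (n + 2)]
      refine Finset.sum_bij (fun p _ => p + 1) ?_ ?_ ?_ ?_
      · intro a ha; simp at *; omega
      · intro a _ b _ h; omega
      · intro b hb; simp at hb; exact ⟨b - 1, by simp; omega, by omega⟩
      · intro a _; rfl
    rw [Finset.sum_congr rfl fun π _ => e1 π, Finset.sum_add_distrib, ← map_sum, ← Finset.mul_sum, ih,
      d.leibniz, h1, aeval_DQ d, Q]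
    · simp; ring
    · simp [d.leibniz, h1, h2]; ring
    · simp [d.leibniz, h3, h4, hs]; ring
    · simp [h3, h4]; ring
    · simpa using hs

theorem CW_sum {R : Type*} [CommRing R] [Algebra ℝ R] (d : Derivation ℝ R R) (v f a b s : R)
    (hv : d v = v * (a + b)) (hf : d f = (s + 1) * v) (ha : d a = v) (hb : d b = v) (hs : d s = 0)
    (n : ℕ) :
    ∑ e : Equiv.Perm (Fin n), CW v f a b s e =
      MvPolynomial.aeval ![v, f, a + b, s] (Q n) := by
  induction n with
  | zero => simp [CW, Q]
  | succ n ih =>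
    rw [← Equiv.sum_comp Equiv.Perm.decomposeFin.symm, Fintype.sum_prod_type, Finset.sum_comm,
      Finset.sum_congr rfl fun e _ => CW_rec d v f a b s hv hf ha hb hs e,
      Finset.sum_add_distrib, ← map_sum, ← Finset.mul_sum, ih, aeval_DQ d, Q]
    · simp
    · simpa using hv
    · simpa using hf
    · simp [ha, hb]; ring
    · simpa using hs

theorem map_LW {R S : Type*} [CommRing R] [CommRing S] (φ : R →+* S) (x1 x2 x3 x4 s : R)
    (u : ℕ → ℕ) (m : ℕ) :
    φ (LW x1 x2 x3 x4 s u m) = LW (φ x1) (φ x2) (φ x3) (φ x4) (φ s) u m := by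
  simp only [LW, lw, map_mul, map_prod, apply_ite φ, map_one]

theorem map_CW {R S : Type*} [CommRing R] [CommRing S] (φ : R →+* S) (v f a b s : R)
    {n : ℕ} (e : Equiv.Perm (Fin n)) :
    φ (CW v f a b s e) = CW (φ v) (φ f) (φ a) (φ b) (φ s) e := by
  simp only [CW, cw, map_mul, map_prod, apply_ite φ, map_one, map_pow, map_add]

theorem LW_real (n : ℕ) (α : Fin 5 → ℝ) :
    ∑ π : Equiv.Perm (Fin (n + 1)), LW (α 0) (α 1) (α 2) (α 3) (α 4) (word π) (n + 1) =
      α 0 * MvPolynomial.aeval ![α 0 * α 1, α 4 * α 2 + α 3, α 2 + α 3, α 4] (Q n) := by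
  let d : Derivation ℝ (MvPolynomial (Fin 5) ℝ) (MvPolynomial (Fin 5) ℝ) :=
    MvPolynomial.mkDerivation ℝ ![.X 0 * (.X 2 + .X 3), 0, .X 0 * .X 1, .X 0 * .X 1, 0]
  have h := LW_sum d (.X 0) (.X 1) (.X 2) (.X 3) (.X 4) (by simp [d, MvPolynomial.mkDerivation_X])
    (by simp [d, MvPolynomial.mkDerivation_X]) (by simp [d, MvPolynomial.mkDerivation_X])
    (by simp [d, MvPolynomial.mkDerivation_X]) (by simp [d, MvPolynomial.mkDerivation_X]) n
  have h' := congrArg (MvPolynomial.aeval α) h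
  rw [map_sum, map_mul, ← AlgHom.comp_apply, MvPolynomial.comp_aeval] at h'
  have e1 : (fun i => (MvPolynomial.aeval α) ((![.X 0 * .X 1, .X 4 * .X 2 + .X 3, .X 2 + .X 3, .X 4] :
      Fin 4 → MvPolynomial (Fin 5) ℝ) i)) = ![α 0 * α 1, α 4 * α 2 + α 3, α 2 + α 3, α 4] := by
    funext i; fin_cases i <;> simp
  rw [e1] at h'
  simp only [MvPolynomial.aeval_X] at h'
  rw [← h']
  refine Finset.sum_congr rfl fun π _ => ?_
  have := map_LW (MvPolynomial.aeval α : MvPolynomial (Fin 5) ℝ →ₐ[ℝ] ℝ).toRingHom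
    (.X 0) (.X 1) (.X 2) (.X 3) (.X 4) (word π) (n + 1)
  simp at this
  exact this.symm

theorem CW_real (n : ℕ) (α : Fin 5 → ℝ) :
    ∑ e : Equiv.Perm (Fin n), CW (α 0) (α 1) (α 2) (α 3) (α 4) e =
      MvPolynomial.aeval ![α 0, α 1, α 2 + α 3, α 4] (Q n) := by
  let d : Derivation ℝ (MvPolynomial (Fin 5) ℝ) (MvPolynomial (Fin 5) ℝ) :=
    MvPolynomial.mkDerivation ℝ ![.X 0 * (.X 2 + .X 3), (.X 4 + 1) * .X 0, .X 0, .X 0, 0]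
  have h := CW_sum d (.X 0) (.X 1) (.X 2) (.X 3) (.X 4) (by simp [d, MvPolynomial.mkDerivation_X])
    (by simp [d, MvPolynomial.mkDerivation_X]) (by simp [d, MvPolynomial.mkDerivation_X])
    (by simp [d, MvPolynomial.mkDerivation_X]) (by simp [d, MvPolynomial.mkDerivation_X]) n
  have h' := congrArg (MvPolynomial.aeval α) h
  rw [map_sum, ← AlgHom.comp_apply, MvPolynomial.comp_aeval] at h'
  have e1 : (fun i => (MvPolynomial.aeval α) ((![.X 0, .X 1, .X 2 + .X 3, .X 4] :
      Fin 4 → MvPolynomial (Fin 5) ℝ) i)) = ![α 0, α 1, α 2 + α 3, α 4] := by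
    funext i; fin_cases i <;> simp
  rw [e1] at h'
  rw [← h']
  refine Finset.sum_congr rfl fun e _ => ?_
  have := map_CW (MvPolynomial.aeval α : MvPolynomial (Fin 5) ℝ →ₐ[ℝ] ℝ).toRingHom
    (.X 0) (.X 1) (.X 2) (.X 3) (.X 4) e
  simp at this
  exact this.symm

theorem CW_cda {n : ℕ} (v f b s : ℝ) (e : Equiv.Perm (Fin n)) (h : cda e ≠ 0) :
    CW v f 0 b s e = 0 := by
  unfold cda at h
  obtain ⟨x, hx⟩ := Finset.card_ne_zero.1 h
  simp only [mem_filter, mem_univ, true_and] at hx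
  unfold CW
  rw [Finset.prod_eq_zero (mem_univ x), zero_mul]
  have h1 : ((e⁻¹ x : Fin n) : ℕ) < x := hx.1
  have h2 : (x : ℕ) < (e x : Fin n) := hx.2
  rw [cw, if_pos h2, if_pos h1]

theorem CW_eval {n : ℕ} (v f b s : ℝ) (e : Equiv.Perm (Fin n)) (h : cda e = 0) :
    CW v f 0 b s e = v ^ excStat e * f ^ fixStat e * b ^ (n - fixStat e - 2 * excStat e) *
      (s + 1) ^ (cyc e - fixStat e) := by
  have hno : ∀ x : Fin n, ¬ (e⁻¹ x < x ∧ x < e x) := by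
    intro x hx
    unfold cda at h
    rw [Finset.card_eq_zero] at h
    have : x ∈ (∅ : Finset (Fin n)) := by rw [← h]; simpa using hx
    simp at this
  have hcyc : cyc e - fixStat e = e.cycleType.card := by simp [cyc]
  have hfix : ∀ x : Fin n, e⁻¹ x = x ↔ e x = x := by
    intro x; rw [Equiv.Perm.inv_eq_iff_eq]; exact eq_comm
  have hexc' : excStat e = (univ.filter fun x : Fin n => e⁻¹ x < x).card := by
    unfold excStat
    refine Finset.card_bij (fun x _ => e x) ?_ ?_ ?_
    · intro a ha; simpa using ha
    · intro a _ b _ h; exact e.injective h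
    · intro b hb; exact ⟨e⁻¹ b, by simpa using hb, by simp⟩
  have htot : excStat e + (univ.filter fun x : Fin n => e⁻¹ x < x).card + fixStat e +
      (univ.filter fun x : Fin n => x < e⁻¹ x ∧ e x < x).card = n := by
    unfold excStat fixStat
    simp only [Finset.card_filter]
    rw [← Finset.sum_add_distrib, ← Finset.sum_add_distrib, ← Finset.sum_add_distrib]
    rw [Finset.sum_congr rfl (g := fun _ => 1), Finset.sum_const]
    · simp
    · intro x _
      have h1 := hno x
      have h2 := hfix x
      generalize e⁻¹ x = y at *
      generalize e x = z at *
      rcases lt_trichotomy x z with hz | hz | hz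
      · have : x < y := by
          rcases lt_trichotomy y x with hy | hy | hy
          · exact absurd ⟨hy, hz⟩ h1
          · exact absurd (h2.1 hy) hz.ne'
          · exact hy
        simp [hz, hz.ne', this.not_gt, hz.not_gt]
      · subst hz
        have := h2.2 rfl
        simp [this]
      · rcases lt_trichotomy y x with hy | hy | hy
        · simp [hz.ne, hy, hz.not_gt, hy.not_gt]
        · exact absurd (h2.1 hy) hz.ne
        · simp [hz.ne, hy, hz, hz.not_gt, hy.not_gt]
  have hb : n - fixStat e - 2 * excStat e = (univ.filter fun x : Fin n => x < e⁻¹ x ∧ e x < x).card := by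
    omega
  rw [hcyc, hb, CW]
  congr 1
  unfold excStat fixStat
  simp only [pow_card_eq]
  rw [← Finset.prod_mul_distrib, ← Finset.prod_mul_distrib]
  refine Finset.prod_congr rfl fun x _ => ?_
  have h1 := hno x
  have h2 := hfix x
  unfold cw
  simp only [Fin.val_fin_lt, ← Fin.ext_iff]
  generalize e⁻¹ x = y at *
  generalize e x = z at *
  rcases lt_trichotomy x z with hz | hz | hz
  · have : ¬ y < x := fun hy => h1 ⟨hy, hz⟩
    simp [hz, hz.ne', this, hz.not_gt]
  · subst hz
    simp
  · rcases lt_trichotomy y x with hy | hy | hy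
    · simp [hz.ne, hy, hz.not_gt, hy.not_gt]
    · exact absurd (h2.1 hy) hz.ne
    · simp [hz.ne, hy, hz, hz.not_gt, hy.not_gt]

/-- `Σ_{π ∈ S_{n+1}} α1^pk α2^val α3^dasc α4^ddes s^simsuc
= Σ_{σ ∈ S_n, cda σ = 0} α1^(exc+1) α2^exc (s α3 + α4)^fix (s+1)^(cyc-fix)
(α3+α4)^(n - fix - 2 exc)`. -/
theorem statement16 (n : ℕ) (α1 α2 α3 α4 s : ℝ) :
    ∑ π : Equiv.Perm (Fin (n + 1)),
        α1 ^ pk π * α2 ^ valStat π * α3 ^ dasc π * α4 ^ ddes π * s ^ simsuc π =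
      ∑ σ ∈ Finset.univ.filter fun σ : Equiv.Perm (Fin n) => cda σ = 0,
        α1 ^ (excStat σ + 1) * α2 ^ excStat σ * (s * α3 + α4) ^ fixStat σ *
          (s + 1) ^ (cyc σ - fixStat σ) * (α3 + α4) ^ (n - fixStat σ - 2 * excStat σ) := by
  have hL := LW_real n ![α1, α2, α3, α4, s]
  have hR := CW_real n ![α1 * α2, s * α3 + α4, 0, α3 + α4, s]
  simp only [Matrix.cons_val, zero_add] at hL hR
  rw [← hR] at hL
  rw [Finset.sum_congr rfl fun π _ => (LW_word α1 α2 α3 α4 s (by omega) π).symm, hL,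
    Finset.sum_filter, Finset.mul_sum]
  refine Finset.sum_congr rfl fun σ _ => ?_
  split_ifs with h
  · rw [CW_eval _ _ _ _ σ h, mul_pow]; ring
  · rw [CW_cda _ _ _ _ σ h, mul_zero]

end SucEuler
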